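/- arXiv:2003.14060 — 2 statements merged into one kernel-verified Lean document; each statement's English description precedes it below -/
import Mathlib

section
/- Assume Hypotheses (H_C) and (H_G). Let K ⊆ ℝⁿ be closed with C(t) ∩ K ≠ ∅ for all t ≥ 0, and set 𝒢 := {(t,x) ∈ [0,∞) × ℝⁿ : x ∈ C(t) ∩ K}. Then the following are equivalent: (a) (weak invariance) for every (t₀,x₀) ∈ 𝒢 there exist T > t₀ and a solution x of the perturbed sweeping process on [t₀,T] with x(t₀) = x₀ and x(t) ∈ K for all t ∈ [t₀,T); (b) for every (t,x) ∈ 𝒢 and every p ∈ N^P_𝒢(t,x) one has min{(0,−ξ)·p : ξ ∈ N_{C(t)}(x), ‖ξ‖ ≤ L_C + M} + min{(1,g)·p : g ∈ G(t,x)} ≤ 0. -/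
open scoped Pointwise RealInnerProductSpace ENNReal
open Set Metric MeasureTheory

variable {E : Type*} [NormedAddCommGroup E] [InnerProductSpace ℝ E]

/-- Proximal normal cone to `K` at `x` (empty when `x ∉ K`):
`v ∈ N_K(x)` iff `x ∈ K` and there is `σ ≥ 0` with `⟪v, y - x⟫ ≤ σ‖y - x‖²` for all `y ∈ K`. -/
def proxNormalCone (K : Set E) (x : E) : Set E :=
  {v | x ∈ K ∧ ∃ σ : ℝ, 0 ≤ σ ∧ ∀ y ∈ K, ⟪v, y - x⟫ ≤ σ * ‖y - x‖ ^ 2}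

/-- `r`-prox-regularity of a closed set. -/
def ProxRegular (r : ℝ) (C : Set E) : Prop :=
  ∀ x ∈ C, ∀ y ∈ C, ∀ ζ ∈ proxNormalCone C x,
    ⟪ζ, y - x⟫ ≤ 1 / (2 * r) * ‖ζ‖ * ‖y - x‖ ^ 2

/-- Hypothesis (H_C): values are nonempty, compact, `r`-prox-regular; `L_C`-Lipschitz
for the Hausdorff distance. -/
structure HypC (r L_C : ℝ) (C : ℝ → Set E) : Prop where
  nonempty : ∀ t, 0 ≤ t → (C t).Nonempty
  isCompact : ∀ t, 0 ≤ t → IsCompact (C t)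
  proxRegular : ∀ t, 0 ≤ t → ProxRegular r (C t)
  lipschitz : ∀ s t, 0 ≤ s → 0 ≤ t → hausdorffDist (C s) (C t) ≤ L_C * |s - t|

/-- Hypothesis (H_G): nonempty, closed, convex values, bounded by `M`, `L_G`-Lipschitz
for the Hausdorff distance. -/
structure HypG (M L_G : ℝ) (G : ℝ → E → Set E) : Prop where
  nonempty : ∀ t x, (G t x).Nonempty
  isClosed : ∀ t x, IsClosed (G t x)
  convex : ∀ t x, Convex ℝ (G t x)
  bounded : ∀ t x, ∀ v ∈ G t x, ‖v‖ ≤ M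
  lipschitz : ∀ s t (x y : E), hausdorffDist (G s x) (G t y) ≤ L_G * (|s - t| + ‖x - y‖)

/-- Solution of the perturbed sweeping process `ẋ(t) ∈ -N_{C(t)}(x(t)) + G(t, x(t))`
on `[t0, T]`: an (absolutely continuous) integral of an integrable derivative `x'`
satisfying the differential inclusion a.e., with `x(t) ∈ C(t)` for all `t ∈ [t0, T]`. -/
def IsSweepingSol (C : ℝ → Set E) (G : ℝ → E → Set E) (t0 T : ℝ) (x : ℝ → E) : Prop :=
  (∀ t ∈ Icc t0 T, x t ∈ C t) ∧
  ∃ x' : ℝ → E, IntegrableOn x' (Icc t0 T) ∧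
    (∀ t ∈ Icc t0 T, x t = x t0 + ∫ s in t0..t, x' s) ∧
    ∀ᵐ t ∂(volume.restrict (Icc t0 T)),
      x' t ∈ -proxNormalCone (C t) (x t) + G t (x t)

/-- Minimum time to reach the target `S` subject to the perturbed sweeping process,
starting at `x0 ∈ C t0` at time `t0` (`+∞` if `S` is never reached). -/
noncomputable def minTime (C : ℝ → Set E) (G : ℝ → E → Set E) (S : Set E)
    (t0 : ℝ) (x0 : E) : ℝ≥0∞ :=
  sInf (ENNReal.ofReal '' {a : ℝ | 0 ≤ a ∧ ∃ x : ℝ → E,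
    IsSweepingSol C G t0 (t0 + a) x ∧ x t0 = x0 ∧ x (t0 + a) ∈ S})

/-- Proximal normal cone in the product space `ℝ × E` (with the Euclidean product
inner product `⟪(a,v),(b,w)⟫ = a*b + ⟪v,w⟫`). -/
def proxNormalCone2 (K : Set (ℝ × E)) (q : ℝ × E) : Set (ℝ × E) :=
  {p | q ∈ K ∧ ∃ σ : ℝ, 0 ≤ σ ∧ ∀ q' ∈ K,
    p.1 * (q'.1 - q.1) + ⟪p.2, q'.2 - q.2⟫ ≤ σ * ((q'.1 - q.1) ^ 2 + ‖q'.2 - q.2‖ ^ 2)}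

/-- Proximal normal cone in the product space `ℝ × E × ℝ`. -/
def proxNormalCone3 (K : Set (ℝ × E × ℝ)) (q : ℝ × E × ℝ) : Set (ℝ × E × ℝ) :=
  {p | q ∈ K ∧ ∃ σ : ℝ, 0 ≤ σ ∧ ∀ q' ∈ K,
    p.1 * (q'.1 - q.1) + ⟪p.2.1, q'.2.1 - q.2.1⟫ + p.2.2 * (q'.2.2 - q.2.2) ≤
      σ * ((q'.1 - q.1) ^ 2 + ‖q'.2.1 - q.2.1‖ ^ 2 + (q'.2.2 - q.2.2) ^ 2)}

/-- Proximal normal cone in the product space `E × ℝ`. -/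
def proxNormalConeER (K : Set (E × ℝ)) (q : E × ℝ) : Set (E × ℝ) :=
  {p | q ∈ K ∧ ∃ σ : ℝ, 0 ≤ σ ∧ ∀ q' ∈ K,
    ⟪p.1, q'.1 - q.1⟫ + p.2 * (q'.2 - q.2) ≤ σ * (‖q'.1 - q.1‖ ^ 2 + (q'.2 - q.2) ^ 2)}

/-- The graph of the moving set `C`, i.e. `{(t,x) : t ≥ 0, x ∈ C(t)}`. -/
def graphSet (C : ℝ → Set E) : Set (ℝ × E) := {q | 0 ≤ q.1 ∧ q.2 ∈ C q.1}

open Filter Topology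

/-- Points of a compact set are within the Hausdorff distance of another compact set. -/
lemma IsCompact.exists_norm_sub_le_of_hausdorffDist_le {V : Type*} [SeminormedAddCommGroup V]
    {s t : Set V} (hs : IsCompact s)
    (ht : IsCompact t) (hne : t.Nonempty) {c : ℝ} (h : hausdorffDist s t ≤ c)
    {y : V} (hy : y ∈ s) : ∃ z ∈ t, ‖y - z‖ ≤ c := by
  obtain ⟨z, hz, hyz⟩ := ht.exists_infDist_eq_dist hne y
  refine ⟨z, hz, ?_⟩
  rw [← dist_eq_norm, ← hyz]
  exact (infDist_le_hausdorffDist_of_mem hy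
    (hausdorffEDist_ne_top_of_nonempty_of_bounded ⟨y, hy⟩ hne hs.isBounded ht.isBounded)).trans h

/-- The fundamental theorem of calculus for Lipschitz curves in a finite-dimensional space. -/
lemma LipschitzWith.intervalIntegral_deriv_eq_sub [FiniteDimensional ℝ E] {K : NNReal}
    {f : ℝ → E} (hf : LipschitzWith K f) (a b : ℝ) :
    ∫ s in a..b, deriv f s = f b - f a := by
  have hbound : ∀ s, ‖deriv f s‖ ≤ K := fun s => norm_deriv_le_of_lipschitz hf
  have hloc : LocallyIntegrable (deriv f) :=
    (locallyIntegrable_const (K : ℝ)).mono (stronglyMeasurable_deriv f).aestronglyMeasurable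
      (Eventually.of_forall fun s => by simpa using hbound s)
  have hint (u v : ℝ) : IntervalIntegrable (deriv f) volume u v :=
    intervalIntegrable_iff.2 ((hloc.integrableOn_isCompact isCompact_uIcc).mono_set uIoc_subset_uIcc)
  have hI : LipschitzWith K (fun t => ∫ s in a..t, deriv f s) := by
    refine LipschitzWith.of_dist_le_mul fun u v => ?_
    rw [dist_eq_norm, intervalIntegral.integral_interval_sub_left (hint a u) (hint a v),
      Real.dist_eq]
    exact intervalIntegral.norm_integral_le_of_norm_le_const fun s _ => hbound s
  have hac : AbsolutelyContinuousOnInterval (fun t => f t - ∫ s in a..t, deriv f s) a b :=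
    (hf.sub hI).lipschitzOnWith.absolutelyContinuousOnInterval
  obtain ⟨c, hc⟩ := hac.const_of_ae_hasDerivAt_zero (by
    filter_upwards [hf.ae_differentiableAt_real, LocallyIntegrable.ae_hasDerivAt_integral hloc] with t h1 h2 _
    simpa using h1.hasDerivAt.fun_sub (h2 a))
  have ha := hc a left_mem_uIcc
  have hb := hc b right_mem_uIcc
  simp only [intervalIntegral.integral_same, sub_zero] at ha
  rw [ha, ← hb]
  abel

lemma convex_proxNormalCone (K : Set E) (x : E) : Convex ℝ (proxNormalCone K x) := by
  rintro v ⟨hx, σ, hσ, hv⟩ w ⟨-, ρ, hρ, hw⟩ a b ha hb -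
  refine ⟨hx, a * σ + b * ρ, by positivity, fun y hy => ?_⟩
  rw [inner_add_left, real_inner_smul_left, real_inner_smul_left]
  nlinarith [mul_le_mul_of_nonneg_left (hv y hy) ha, mul_le_mul_of_nonneg_left (hw y hy) hb]

lemma zero_mem_proxNormalCone {K : Set E} {x : E} (hx : x ∈ K) : 0 ∈ proxNormalCone K x :=
  ⟨hx, 0, le_rfl, fun y _ => by simp⟩

namespace HypC

variable {r L_C : ℝ} {C : ℝ → Set E}

lemma lipschitz_const_nonneg (hC : HypC r L_C C) : 0 ≤ L_C := by
  simpa using hausdorffDist_nonneg.trans (hC.lipschitz 0 1 le_rfl zero_le_one)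

lemma exists_norm_sub_le (hC : HypC r L_C C) {s t : ℝ} (hs : 0 ≤ s) (ht : 0 ≤ t) {y : E}
    (hy : y ∈ C s) : ∃ z ∈ C t, ‖y - z‖ ≤ L_C * |s - t| :=
  (hC.isCompact s hs).exists_norm_sub_le_of_hausdorffDist_le (hC.isCompact t ht)
    (hC.nonempty t ht) (hC.lipschitz s t hs ht) hy

/-- A limit of approximants chosen at distance at most `L_C * |s i - t|` from a convergent family. -/
lemma tendsto_of_norm_sub_le {ι V : Type*} [SeminormedAddCommGroup V] {l : Filter ι} {s : ι → ℝ}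
    {y z : ι → V} {t : ℝ} {x : V}
    (hs : Tendsto s l (𝓝 t)) (hy : Tendsto y l (𝓝 x))
    (hz : ∀ i, ‖y i - z i‖ ≤ L_C * |s i - t|) : Tendsto z l (𝓝 x) := by
  have h0 : Tendsto (fun i => L_C * |s i - t|) l (𝓝 0) := by
    simpa using ((hs.sub_const t).abs).const_mul L_C
  simpa using hy.sub (squeeze_zero_norm hz h0)

lemma mem_of_tendsto {ι : Type*} {l : Filter ι} [l.NeBot] (hC : HypC r L_C C) {s : ι → ℝ}
    {y : ι → E} {t : ℝ} {x : E} (hs0 : ∀ i, 0 ≤ s i) (hy0 : ∀ i, y i ∈ C (s i))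
    (hs : Tendsto s l (𝓝 t)) (hy : Tendsto y l (𝓝 x)) : x ∈ C t := by
  have ht : 0 ≤ t := ge_of_tendsto' hs hs0
  choose z hz hyz using fun i => hC.exists_norm_sub_le (hs0 i) ht (hy0 i)
  exact (hC.isCompact t ht).isClosed.mem_of_tendsto (tendsto_of_norm_sub_le hs hy hyz)
    (Eventually.of_forall hz)

lemma mem_proxNormalCone_of_tendsto {ι : Type*} {l : Filter ι} [l.NeBot] (hr : 0 < r)
    (hC : HypC r L_C C) {s : ι → ℝ} {y ξ : ι → E} {t : ℝ} {x ζ : E} (hs0 : ∀ i, 0 ≤ s i)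
    (hξ0 : ∀ i, ξ i ∈ proxNormalCone (C (s i)) (y i))
    (hs : Tendsto s l (𝓝 t)) (hy : Tendsto y l (𝓝 x)) (hξ : Tendsto ξ l (𝓝 ζ)) :
    ζ ∈ proxNormalCone (C t) x := by
  have ht : 0 ≤ t := ge_of_tendsto' hs hs0
  refine ⟨hC.mem_of_tendsto hs0 (fun i => (hξ0 i).1) hs hy, 1 / (2 * r) * ‖ζ‖, by positivity,
    fun w hw => ?_⟩
  choose z hz hwz using fun i => hC.exists_norm_sub_le ht (hs0 i) hw
  have hz' : Tendsto z l (𝓝 w) :=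
    tendsto_of_norm_sub_le hs tendsto_const_nhds fun i => by rw [abs_sub_comm]; exact hwz i
  exact le_of_tendsto_of_tendsto' (hξ.inner (hz'.sub hy))
    ((hξ.norm.const_mul _).mul ((hz'.sub hy).norm.pow 2))
    fun i => hC.proxRegular _ (hs0 i) _ (hξ0 i).1 _ (hz i) _ (hξ0 i)

/-- The normal part of the velocity of a curve that stayed in the moving set is bounded. -/
lemma norm_le_of_hasDerivAt (hr : 0 < r) (hC : HypC r L_C C) {M t : ℝ} {x : ℝ → E} {ξ g : E}
    (ht : 0 ≤ t) (hξ : ξ ∈ proxNormalCone (C t) (x t)) (hg : ‖g‖ ≤ M)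
    (hx : HasDerivAt x (-ξ + g) t) (hmem : ∀ᶠ s in 𝓝[<] t, 0 ≤ s ∧ x s ∈ C s) :
    ‖ξ‖ ≤ L_C + M := by
  have hslope : Tendsto (slope x t) (𝓝[<] t) (𝓝 (-ξ + g)) :=
    (hasDerivAt_iff_tendsto_slope.1 hx).mono_left (nhdsWithin_mono _ fun s hs => ne_of_lt hs)
  have hs0 : Tendsto (fun s : ℝ => t - s) (𝓝[<] t) (𝓝 0) := by
    have : Tendsto (fun s : ℝ => t - s) (𝓝 t) (𝓝 (t - t)) := tendsto_const_nhds.sub tendsto_id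
    simpa using this.mono_left nhdsWithin_le_nhds
  have hlim := (((tendsto_const_nhds (x := L_C)).add hslope.norm).pow 2).mul hs0
  have hlim2 := (tendsto_const_nhds (x := ‖ξ‖ * L_C)).add (hlim.const_mul (1 / (2 * r) * ‖ξ‖))
  have key : ⟪ξ, -(-ξ + g)⟫ ≤ ‖ξ‖ * L_C := by
    have := le_of_tendsto_of_tendsto
      ((tendsto_const_nhds (x := ξ)).inner hslope.neg) hlim2 ?_
    · simpa using this
    filter_upwards [hmem, self_mem_nhdsWithin] with s hs hst
    have hst' : 0 < t - s := sub_pos.2 hst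
    obtain ⟨y, hy, hxy⟩ := hC.exists_norm_sub_le hs.1 ht hs.2
    have habs : |s - t| = t - s := by rw [abs_sub_comm, abs_of_pos hst']
    rw [habs] at hxy
    have hsl : x s - x t = (t - s) • (-slope x t s) := by
      rw [← vsub_eq_sub, ← sub_smul_slope x t s, smul_neg, ← neg_smul, neg_sub]
    have h1 := hC.proxRegular t ht _ hξ.1 y hy ξ hξ
    have h2 : ⟪ξ, x s - y⟫ ≤ ‖ξ‖ * (L_C * (t - s)) :=
      (real_inner_le_norm _ _).trans (by gcongr)
    have h3 : ‖y - x t‖ ≤ (t - s) * (L_C + ‖slope x t s‖) := by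
      calc ‖y - x t‖ = ‖-(x s - y) + (x s - x t)‖ := by congr 1; abel
        _ ≤ ‖x s - y‖ + ‖x s - x t‖ := (norm_add_le _ _).trans (by rw [norm_neg])
        _ ≤ L_C * (t - s) + (t - s) * ‖slope x t s‖ := by
          gcongr
          rw [hsl, norm_smul, norm_neg, Real.norm_of_nonneg hst'.le]
        _ = _ := by ring
    have h4 : ⟪ξ, x s - x t⟫ = (t - s) * ⟪ξ, -slope x t s⟫ := by
      rw [hsl, real_inner_smul_right]
    have h5 : ⟪ξ, x s - x t⟫ = ⟪ξ, x s - y⟫ + ⟪ξ, y - x t⟫ := by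
      rw [← inner_add_right]; congr 1; abel
    have h6 : 1 / (2 * r) * ‖ξ‖ * ‖y - x t‖ ^ 2 ≤
        1 / (2 * r) * ‖ξ‖ * ((t - s) * (L_C + ‖slope x t s‖)) ^ 2 := by gcongr
    refine le_of_mul_le_mul_left ?_ hst'
    calc (t - s) * ⟪ξ, -slope x t s⟫ ≤ ‖ξ‖ * (L_C * (t - s)) +
          1 / (2 * r) * ‖ξ‖ * ((t - s) * (L_C + ‖slope x t s‖)) ^ 2 := by linarith
      _ = _ := by ring
  rw [neg_add, neg_neg, inner_add_right, inner_neg_right, real_inner_self_eq_norm_sq] at key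
  have h7 : ⟪ξ, g⟫ ≤ ‖ξ‖ * M := (real_inner_le_norm _ _).trans (by gcongr)
  rcases (norm_nonneg ξ).eq_or_lt with h | h
  · rw [← h]
    exact add_nonneg hC.lipschitz_const_nonneg ((norm_nonneg g).trans hg)
  · refine le_of_mul_le_mul_left ?_ h
    nlinarith

end HypC

namespace HypG

variable {M L_G : ℝ} {G : ℝ → E → Set E}

lemma bound_nonneg (hG : HypG M L_G G) : 0 ≤ M := by
  obtain ⟨v, hv⟩ := hG.nonempty 0 0
  exact (norm_nonneg v).trans (hG.bounded 0 0 v hv)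

lemma isCompact [FiniteDimensional ℝ E] (hG : HypG M L_G G) (t : ℝ) (x : E) :
    IsCompact (G t x) :=
  have := FiniteDimensional.proper_real E
  (isCompact_closedBall (0 : E) M).of_isClosed_subset (hG.isClosed t x) fun v hv => by
    simpa using hG.bounded t x v hv

end HypG

/-- The velocities `-ξ + g` with `ξ ∈ N_{C(t)}(x)`, `‖ξ‖ ≤ R` and `g ∈ G(t, x)`. -/
def truncatedVelocity (R : ℝ) (C : ℝ → Set E) (G : ℝ → E → Set E) (t : ℝ) (x : E) : Set E :=
  {v | ∃ ξ ∈ proxNormalCone (C t) x, ‖ξ‖ ≤ R ∧ ∃ g ∈ G t x, v = -ξ + g}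

section truncatedVelocity

variable {r L_C M L_G R : ℝ} {C : ℝ → Set E} {G : ℝ → E → Set E}

lemma norm_le_of_mem_truncatedVelocity (hG : HypG M L_G G) {t : ℝ} {x v : E}
    (hv : v ∈ truncatedVelocity R C G t x) : ‖v‖ ≤ R + M := by
  obtain ⟨ξ, -, hξR, g, hg, rfl⟩ := hv
  refine (norm_add_le _ _).trans ?_
  rw [norm_neg]
  exact add_le_add hξR (hG.bounded _ _ g hg)

lemma convex_truncatedVelocity (hG : HypG M L_G G) (t : ℝ) (x : E) :
    Convex ℝ (truncatedVelocity R C G t x) := by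
  rintro _ ⟨ξ, hξ, hξR, g, hg, rfl⟩ _ ⟨ξ', hξ', hξR', g', hg', rfl⟩ a b ha hb hab
  refine ⟨a • ξ + b • ξ', convex_proxNormalCone _ _ hξ hξ' ha hb hab, ?_,
    a • g + b • g', hG.convex t x hg hg' ha hb hab, ?_⟩
  · have := convex_closedBall (0 : E) R (x := ξ) (by simpa) (y := ξ') (by simpa) ha hb hab
    simpa using this
  · simp only [smul_add, smul_neg, neg_add]
    abel

variable [FiniteDimensional ℝ E]

lemma isCompact_proxNormalCone_inter (hr : 0 < r) (hC : HypC r L_C C) {t : ℝ} (ht : 0 ≤ t)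
    (x : E) : IsCompact {ξ | ξ ∈ proxNormalCone (C t) x ∧ ‖ξ‖ ≤ R} := by
  have := FiniteDimensional.proper_real E
  refine (isCompact_closedBall (0 : E) R).of_isClosed_subset ?_ fun ξ hξ => by simpa using hξ.2
  refine IsSeqClosed.isClosed fun ξ ζ hξ hlim => ⟨?_, ?_⟩
  · exact hC.mem_proxNormalCone_of_tendsto hr (fun _ => ht) (fun i => (hξ i).1)
      tendsto_const_nhds tendsto_const_nhds hlim
  · exact le_of_tendsto' hlim.norm fun i => (hξ i).2

lemma isCompact_truncatedVelocity (hr : 0 < r) (hC : HypC r L_C C) (hG : HypG M L_G G) {t : ℝ}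
    (ht : 0 ≤ t) (x : E) : IsCompact (truncatedVelocity R C G t x) := by
  have h := ((isCompact_proxNormalCone_inter (R := R) hr hC ht x).prod (hG.isCompact t x)).image
    (f := fun q : E × E => -q.1 + q.2) (by fun_prop)
  convert h using 1
  ext v
  constructor
  · rintro ⟨ξ, hξ, hξR, g, hg, rfl⟩
    exact ⟨(ξ, g), ⟨⟨hξ, hξR⟩, hg⟩, rfl⟩
  · rintro ⟨⟨ξ, g⟩, ⟨⟨hξ, hξR⟩, hg⟩, rfl⟩
    exact ⟨ξ, hξ, hξR, g, hg, rfl⟩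

/-- Upper semicontinuity of the truncated velocity map along the graph of the moving set. -/
lemma exists_truncatedVelocity_subset_cthickening (hr : 0 < r) (hC : HypC r L_C C)
    (hG : HypG M L_G G) (t : ℝ) (x : E) {ε : ℝ} (hε : 0 < ε) :
    ∃ δ > 0, ∀ s y, 0 ≤ s → |s - t| ≤ δ → ‖y - x‖ ≤ δ →
      truncatedVelocity R C G s y ⊆ cthickening ε (truncatedVelocity R C G t x) := by
  by_contra! hcon
  have hpos : ∀ k : ℕ, (0 : ℝ) < 1 / ((k : ℝ) + 1) := fun k => by positivity
  choose s y hs0 hst hyx hnot using fun k : ℕ => hcon _ (hpos k)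
  choose v hv hvn using fun k => Set.not_subset.1 (hnot k)
  choose ξ hξ hξR g hg hvξ using hv
  have hlim0 := tendsto_one_div_add_atTop_nhds_zero_nat (𝕜 := ℝ)
  have hs : Tendsto s atTop (𝓝 t) := by
    rw [tendsto_iff_norm_sub_tendsto_zero]
    exact squeeze_zero (fun _ => norm_nonneg _) hst hlim0
  have hy : Tendsto y atTop (𝓝 x) := by
    rw [tendsto_iff_norm_sub_tendsto_zero]
    exact squeeze_zero (fun _ => norm_nonneg _) hyx hlim0
  have := FiniteDimensional.proper_real E
  obtain ⟨ζ, hζ, φ, hφ, hξζ⟩ := (isCompact_closedBall (0 : E) R).tendsto_subseq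
    (x := ξ) fun k => by simpa using hξR k
  have hφ' := hφ.tendsto_atTop
  have hζN : ζ ∈ proxNormalCone (C t) x :=
    hC.mem_proxNormalCone_of_tendsto hr (fun k => hs0 (φ k)) (fun k => hξ (φ k))
      (hs.comp hφ') (hy.comp hφ') hξζ
  choose g' hg' hgg' using fun k => (hG.isCompact (s k) (y k)).exists_norm_sub_le_of_hausdorffDist_le
    (hG.isCompact t x) (hG.nonempty t x) (hG.lipschitz (s k) t (y k) x) (hg k)
  have hlim : Tendsto (fun k => ‖ξ (φ k) - ζ‖ +
      L_G * (|s (φ k) - t| + ‖y (φ k) - x‖)) atTop (𝓝 0) := by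
    have h1 := (tendsto_iff_norm_sub_tendsto_zero.1 hξζ)
    have h2 := (tendsto_iff_norm_sub_tendsto_zero.1 (hs.comp hφ'))
    have h3 := (tendsto_iff_norm_sub_tendsto_zero.1 (hy.comp hφ'))
    simpa using h1.add ((h2.add h3).const_mul L_G)
  obtain ⟨k, hk⟩ := (hlim.eventually (gt_mem_nhds hε)).exists
  refine hvn (φ k) (mem_cthickening_of_dist_le _ (-ζ + g' (φ k)) _ _
    ⟨ζ, hζN, by simpa using hζ, _, hg' _, rfl⟩ ?_)
  rw [dist_eq_norm, hvξ]
  calc ‖-ξ (φ k) + g (φ k) - (-ζ + g' (φ k))‖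
      = ‖-(ξ (φ k) - ζ) + (g (φ k) - g' (φ k))‖ := by congr 1; abel
    _ ≤ ‖ξ (φ k) - ζ‖ + ‖g (φ k) - g' (φ k)‖ := (norm_add_le _ _).trans (by rw [norm_neg])
    _ ≤ _ := (add_le_add le_rfl (hgg' (φ k))).trans hk.le

end truncatedVelocity

section Necessity

variable [FiniteDimensional ℝ E] {r L_C M L_G : ℝ} {C : ℝ → Set E} {G : ℝ → E → Set E}
  {t₀ T : ℝ} {x : ℝ → E}

/-- The velocity of a solution belongs almost everywhere to the truncated velocity set. -/
lemma IsSweepingSol.exists_velocity_mem_truncatedVelocity (hr : 0 < r) (hC : HypC r L_C C)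
    (hG : HypG M L_G G) (ht₀ : 0 ≤ t₀) (hT : t₀ < T) (hx : IsSweepingSol C G t₀ T x) :
    ∃ x' : ℝ → E, IntegrableOn x' (Icc t₀ T) ∧
      (∀ t ∈ Icc t₀ T, x t = x t₀ + ∫ s in t₀..t, x' s) ∧
      ∀ᵐ t, t ∈ Icc t₀ T → x' t ∈ truncatedVelocity (L_C + M) C G t (x t) := by
  obtain ⟨hmem, x', hint, hx', hae⟩ := hx
  refine ⟨x', hint, hx', ?_⟩
  have hint' : IntervalIntegrable x' volume t₀ T :=
    (intervalIntegrable_iff_integrableOn_Icc_of_le hT.le).2 hint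
  have h₁ : ∀ᵐ t : ℝ, t ≠ t₀ := by simp [ae_iff, measure_singleton]
  have h₂ : ∀ᵐ t : ℝ, t ≠ T := by simp [ae_iff, measure_singleton]
  filter_upwards [(ae_restrict_iff' measurableSet_Icc).1 hae, hint'.ae_hasDerivAt_integral, h₁, h₂]
    with t hv hd ht1 ht2 ht
  have hIoo : t ∈ Ioo t₀ T := ⟨lt_of_le_of_ne ht.1 ht1.symm, lt_of_le_of_ne ht.2 ht2⟩
  rw [uIcc_of_le hT.le] at hd
  obtain ⟨a, ha, g, hg, hag⟩ := Set.mem_add.1 (hv ht)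
  have hder : HasDerivAt x (-(-a) + g) t := by
    rw [neg_neg, hag]
    refine ((hd ht t₀ (left_mem_Icc.2 hT.le)).const_add (x t₀)).congr_of_eventuallyEq ?_
    filter_upwards [Ioo_mem_nhds hIoo.1 hIoo.2] with s hs using hx' s (Ioo_subset_Icc_self hs)
  refine ⟨-a, ha, hC.norm_le_of_hasDerivAt hr (ht₀.trans ht.1) ha (hG.bounded _ _ g hg) hder ?_,
    g, hg, by rw [neg_neg, hag]⟩
  filter_upwards [nhdsWithin_le_nhds (Ioo_mem_nhds hIoo.1 hIoo.2)] with s hs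
  exact ⟨ht₀.trans hs.1.le, hmem s (Ioo_subset_Icc_self hs)⟩

/-- Right difference quotients of a solution are asymptotically admissible velocities. -/
lemma IsSweepingSol.eventually_slope_mem_cthickening (hr : 0 < r) (hC : HypC r L_C C)
    (hG : HypG M L_G G) (ht₀ : 0 ≤ t₀) (hT : t₀ < T) (hx : IsSweepingSol C G t₀ T x) {ε : ℝ}
    (hε : 0 < ε) :
    ∀ᶠ h in 𝓝[>] (0 : ℝ), h⁻¹ • (x (t₀ + h) - x t₀) ∈
      cthickening ε (truncatedVelocity (L_C + M) C G t₀ (x t₀)) := by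
  obtain ⟨x', hint, hx', hae⟩ := hx.exists_velocity_mem_truncatedVelocity hr hC hG ht₀ hT
  obtain ⟨δ, hδ, husc⟩ := exists_truncatedVelocity_subset_cthickening (R := L_C + M) hr hC hG
    t₀ (x t₀) hε
  have hcont : ContinuousOn x (Icc t₀ T) := by
    have h1 : ContinuousOn (fun t => ∫ s in t₀..t, x' s) (Icc t₀ T) := by
      have := intervalIntegral.continuousOn_primitive_interval (a := t₀) (b := T) (f := x')
        (μ := volume) (by rwa [uIcc_of_le hT.le])
      rwa [uIcc_of_le hT.le] at this
    exact (h1.const_add (x t₀)).congr hx'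
  obtain ⟨η, hη, hclose⟩ := Metric.continuousWithinAt_iff.1 (hcont t₀ (left_mem_Icc.2 hT.le)) δ hδ
  have hsmall : ∀ᶠ h in 𝓝[>] (0 : ℝ), h < min (T - t₀) (min η δ) :=
    nhdsWithin_le_nhds (gt_mem_nhds (lt_min (sub_pos.2 hT) (lt_min hη hδ)))
  filter_upwards [hsmall, self_mem_nhdsWithin] with h hh (h0 : 0 < h)
  simp only [lt_min_iff] at hh
  obtain ⟨hhT, hhη, hhδ⟩ := hh
  have hle : t₀ ≤ t₀ + h := by linarith
  have hsub : Ioc t₀ (t₀ + h) ⊆ Icc t₀ T := fun s hs => ⟨hs.1.le, by linarith [hs.2]⟩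
  have havg := ((convex_truncatedVelocity (R := L_C + M) (C := C) hG t₀ (x t₀)).cthickening
    ε).set_average_mem (μ := volume) (t := Ioc t₀ (t₀ + h)) (f := x') isClosed_cthickening
    (by simp [h0]) (by simp) ?_ (hint.mono_set hsub)
  · rw [← uIoc_of_le hle, interval_average_eq] at havg
    rw [hx' (t₀ + h) ⟨hle, by linarith⟩]
    simpa using havg
  · rw [ae_restrict_iff' measurableSet_Ioc]
    filter_upwards [hae] with s hs hsI
    have hsT := hsub hsI
    have hd : |s - t₀| ≤ h := by rw [abs_of_nonneg (by linarith [hsI.1])]; linarith [hsI.2]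
    refine husc s (x s) (ht₀.trans hsT.1) (hd.trans hhδ.le) ?_ (hs hsT)
    rw [← dist_eq_norm]
    exact (hclose hsT (by rw [Real.dist_eq]; linarith)).le

/-- Lower Hamiltonian inequality along a solution staying in a set, at its initial point. -/
lemma IsSweepingSol.sInf_add_sInf_nonpos (hr : 0 < r) (hC : HypC r L_C C)
    (hG : HypG M L_G G) (ht₀ : 0 ≤ t₀) (hT : t₀ < T) (hx : IsSweepingSol C G t₀ T x)
    {S : Set (ℝ × E)} (hS : ∀ t ∈ Ico t₀ T, (t, x t) ∈ S) {p : ℝ × E}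
    (hp : p ∈ proxNormalCone2 S (t₀, x t₀)) :
    sInf {a : ℝ | ∃ ξ ∈ proxNormalCone (C t₀) (x t₀), ‖ξ‖ ≤ L_C + M ∧ a = ⟪-ξ, p.2⟫} +
      sInf {a : ℝ | ∃ g ∈ G t₀ (x t₀), a = p.1 + ⟪g, p.2⟫} ≤ 0 := by
  obtain ⟨-, σ, hσ, hp⟩ := hp
  set m := sInf {a : ℝ | ∃ ξ ∈ proxNormalCone (C t₀) (x t₀), ‖ξ‖ ≤ L_C + M ∧ a = ⟪-ξ, p.2⟫} +
      sInf {a : ℝ | ∃ g ∈ G t₀ (x t₀), a = p.1 + ⟪g, p.2⟫} with hm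
  have hlow : ∀ v ∈ truncatedVelocity (L_C + M) C G t₀ (x t₀), m ≤ p.1 + ⟪v, p.2⟫ := by
    rintro _ ⟨ξ, hξ, hξR, g, hg, rfl⟩
    rw [inner_add_left, add_left_comm]
    refine add_le_add (csInf_le ⟨-((L_C + M) * ‖p.2‖), ?_⟩ ⟨ξ, hξ, hξR, rfl⟩)
      (csInf_le ⟨p.1 - M * ‖p.2‖, ?_⟩ ⟨g, hg, rfl⟩)
    · rintro _ ⟨ζ, -, hζR, rfl⟩
      refine neg_le_of_abs_le ((abs_real_inner_le_norm _ _).trans ?_)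
      rw [norm_neg]
      gcongr
    · rintro _ ⟨g', hg', rfl⟩
      have : |⟪g', p.2⟫| ≤ M * ‖p.2‖ :=
        (abs_real_inner_le_norm _ _).trans (by gcongr; exact hG.bounded _ _ _ hg')
      linarith [neg_le_of_abs_le this]
  have key : ∀ ε > 0, m ≤ ε * ‖p.2‖ := by
    intro ε hε
    have hlim : Tendsto (fun h : ℝ => σ * (h * (1 + (L_C + M + M + ε) ^ 2)) + ε * ‖p.2‖)
        (𝓝[>] 0) (𝓝 (σ * (0 * (1 + (L_C + M + M + ε) ^ 2)) + ε * ‖p.2‖)) :=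
      (Continuous.tendsto (by fun_prop) 0).mono_left nhdsWithin_le_nhds
    simp only [zero_mul, mul_zero, zero_add] at hlim
    refine ge_of_tendsto hlim ?_
    have hhT : ∀ᶠ h in 𝓝[>] (0 : ℝ), h < T - t₀ :=
      nhdsWithin_le_nhds (gt_mem_nhds (sub_pos.2 hT))
    filter_upwards [hx.eventually_slope_mem_cthickening hr hC hG ht₀ hT hε, hhT,
      self_mem_nhdsWithin] with h hw hhT (h0 : 0 < h)
    set w := h⁻¹ • (x (t₀ + h) - x t₀) with hwdef
    rw [(isCompact_truncatedVelocity hr hC hG ht₀ (x t₀)).cthickening_eq_biUnion_closedBall hε.le]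
      at hw
    obtain ⟨v, hv, hwv⟩ := Set.mem_iUnion₂.1 hw
    rw [mem_closedBall, dist_eq_norm] at hwv
    have hwx : x (t₀ + h) - x t₀ = h • w := by rw [hwdef, smul_inv_smul₀ h0.ne']
    have h1 := hp (t₀ + h, x (t₀ + h)) (hS _ ⟨by linarith, by linarith⟩)
    simp only [add_sub_cancel_left, hwx, inner_smul_right, norm_smul, Real.norm_eq_abs,
      mul_pow, sq_abs] at h1
    have hwn : ‖w‖ ≤ L_C + M + M + ε := by
      have := norm_le_of_mem_truncatedVelocity hG hv
      calc ‖w‖ = ‖v + (w - v)‖ := by congr 1; abel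
        _ ≤ ‖v‖ + ‖w - v‖ := norm_add_le _ _
        _ ≤ _ := add_le_add this hwv
    have h2 : p.1 + ⟪p.2, w⟫ ≤ σ * (h * (1 + (L_C + M + M + ε) ^ 2)) := by
      refine le_of_mul_le_mul_left ?_ h0
      calc h * (p.1 + ⟪p.2, w⟫) = p.1 * h + h * ⟪p.2, w⟫ := by ring
        _ ≤ σ * (h ^ 2 + h ^ 2 * ‖w‖ ^ 2) := h1
        _ ≤ σ * (h ^ 2 + h ^ 2 * (L_C + M + M + ε) ^ 2) := by gcongr
        _ = _ := by ring
    have h3 : ⟪v - w, p.2⟫ ≤ ε * ‖p.2‖ := by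
      refine (real_inner_le_norm _ _).trans ?_
      rw [norm_sub_rev]
      gcongr
    rw [inner_sub_left, real_inner_comm p.2 w] at h3
    linarith [hlow v hv]
  have hlim : Tendsto (fun ε : ℝ => ε * ‖p.2‖) (𝓝[>] 0) (𝓝 (0 * ‖p.2‖)) :=
    (Continuous.tendsto (by fun_prop) 0).mono_left nhdsWithin_le_nhds
  rw [zero_mul] at hlim
  exact ge_of_tendsto hlim (by filter_upwards [self_mem_nhdsWithin] with ε hε using key ε hε)

end Necessity

section Euler

/-- Nodes of the Euler scheme with step `h` for the velocity selection `V`. -/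
def eulerNode (V : ℝ → E → E) (t₀ : ℝ) (x₀ : E) (h : ℝ) : ℕ → E
  | 0 => x₀
  | i + 1 => eulerNode V t₀ x₀ h i + h • V (t₀ + i * h) (eulerNode V t₀ x₀ h i)

variable {V : ℝ → E → E} {t₀ : ℝ} {x₀ : E} {h R : ℝ}

lemma eulerNode_sub {i j : ℕ} (hij : i ≤ j) :
    eulerNode V t₀ x₀ h j - eulerNode V t₀ x₀ h i =
      h • ∑ l ∈ Finset.Ico i j, V (t₀ + l * h) (eulerNode V t₀ x₀ h l) := by
  induction j, hij using Nat.le_induction with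
  | base => simp
  | succ j hij ih =>
    rw [Finset.sum_Ico_succ_top hij, smul_add, ← ih, eulerNode]
    abel

lemma norm_eulerNode_sub_le (hV : ∀ τ y, ‖V τ y‖ ≤ R) (hh : 0 ≤ h) {i j : ℕ} (hij : i ≤ j) :
    ‖eulerNode V t₀ x₀ h j - eulerNode V t₀ x₀ h i‖ ≤ R * (((j : ℝ) - i) * h) := by
  rw [eulerNode_sub hij, norm_smul, Real.norm_of_nonneg hh]
  calc h * ‖∑ l ∈ Finset.Ico i j, V (t₀ + l * h) (eulerNode V t₀ x₀ h l)‖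
      ≤ h * ∑ l ∈ Finset.Ico i j, R := by
        gcongr
        exact norm_sum_le_of_le _ fun l _ => hV _ _
    _ = _ := by
        rw [Finset.sum_const, Nat.card_Ico, nsmul_eq_mul, Nat.cast_sub hij]
        ring

/-- Proximal aiming: the Euler nodes stay close to the target set. -/
lemma sq_dist_eulerNode_le {S : Set (ℝ × E)} {P : ℝ → E → ℝ × E} (hV : ∀ τ y, ‖V τ y‖ ≤ R)
    (hP : ∀ τ y, P τ y ∈ S)
    (hmin : ∀ τ y, ∀ q ∈ S, (τ - (P τ y).1) ^ 2 + ‖y - (P τ y).2‖ ^ 2 ≤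
      (τ - q.1) ^ 2 + ‖y - q.2‖ ^ 2)
    (haim : ∀ τ y, (τ - (P τ y).1) + ⟪V τ y, y - (P τ y).2⟫ ≤ 0)
    (h₀ : (t₀, x₀) ∈ S) (hh : 0 ≤ h) (i : ℕ) :
    (t₀ + i * h - (P (t₀ + i * h) (eulerNode V t₀ x₀ h i)).1) ^ 2 +
      ‖eulerNode V t₀ x₀ h i - (P (t₀ + i * h) (eulerNode V t₀ x₀ h i)).2‖ ^ 2 ≤
      i * h * (h * (1 + R ^ 2)) := by
  induction i with
  | zero => simpa [eulerNode] using hmin (t₀ + (0 : ℕ) * h) x₀ _ h₀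
  | succ i ih =>
    set y := eulerNode V t₀ x₀ h i with hy
    set τ := t₀ + i * h with hτ
    have hτ' : t₀ + ((i + 1 : ℕ) : ℝ) * h = τ + h := by push_cast; ring
    have hy' : eulerNode V t₀ x₀ h (i + 1) = y + h • V τ y := rfl
    rw [hτ', hy']
    refine (hmin (τ + h) (y + h • V τ y) _ (hP τ y)).trans ?_
    have h1 : ‖y + h • V τ y - (P τ y).2‖ ^ 2 =
        ‖y - (P τ y).2‖ ^ 2 + 2 * (h * ⟪V τ y, y - (P τ y).2⟫) + h ^ 2 * ‖V τ y‖ ^ 2 := by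
      rw [show y + h • V τ y - (P τ y).2 = (y - (P τ y).2) + h • V τ y by abel,
        norm_add_sq_real, real_inner_smul_right, norm_smul, mul_pow, Real.norm_eq_abs, sq_abs,
        real_inner_comm]
    have h2 : ‖V τ y‖ ^ 2 ≤ R ^ 2 := by gcongr; exact hV τ y
    have h3 := mul_le_mul_of_nonneg_left (haim τ y) hh
    have h4 := mul_le_mul_of_nonneg_left h2 (sq_nonneg h)
    rw [h1]
    push_cast
    nlinarith

lemma Nat.cast_floor_sub_cast_floor_le {a b : ℝ} (hab : a ≤ b) :
    (⌊b⌋₊ : ℝ) - ⌊a⌋₊ ≤ b - a + 1 := by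
  rcases le_total 0 b with hb | hb
  · linarith [Nat.floor_le hb, Nat.lt_floor_add_one a]
  · rw [Nat.floor_of_nonpos hb]
    simp only [Nat.cast_zero, zero_sub]
    linarith [Nat.cast_nonneg (α := ℝ) ⌊a⌋₊]

/-- The piecewise constant interpolation of the Euler nodes. -/
noncomputable def eulerCurve (V : ℝ → E → E) (t₀ : ℝ) (x₀ : E) (h t : ℝ) : E :=
  eulerNode V t₀ x₀ h ⌊(t - t₀) / h⌋₊

lemma eulerCurve_self : eulerCurve V t₀ x₀ h t₀ = x₀ := by
  simp [eulerCurve, eulerNode]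

lemma norm_eulerCurve_sub_le (hV : ∀ τ y, ‖V τ y‖ ≤ R) (hR : 0 ≤ R) (hh : 0 < h) (s t : ℝ) :
    ‖eulerCurve V t₀ x₀ h t - eulerCurve V t₀ x₀ h s‖ ≤ R * (|t - s| + h) := by
  wlog hst : s ≤ t generalizing s t
  · rw [norm_sub_rev, abs_sub_comm]
    exact this t s (le_of_not_ge hst)
  have h1 : (s - t₀) / h ≤ (t - t₀) / h := by gcongr
  refine (norm_eulerNode_sub_le hV hh.le (Nat.floor_mono h1)).trans ?_
  rw [abs_of_nonneg (sub_nonneg.2 hst)]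
  gcongr
  calc _ ≤ ((t - t₀) / h - (s - t₀) / h + 1) * h := by
        gcongr
        exact Nat.cast_floor_sub_cast_floor_le h1
    _ = _ := by field_simp; ring

lemma abs_add_floor_mul_sub_le (hh : 0 < h) {t : ℝ} (ht : t₀ ≤ t) :
    |t₀ + (⌊(t - t₀) / h⌋₊ : ℝ) * h - t| ≤ h := by
  have h1 := Nat.floor_le (div_nonneg (sub_nonneg.2 ht) hh.le)
  have h2 := Nat.lt_floor_add_one ((t - t₀) / h)
  rw [le_div_iff₀ hh] at h1
  rw [div_lt_iff₀ hh] at h2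
  rw [abs_le]
  constructor <;> nlinarith

/-- Averaged velocities of the Euler scheme lie in a convex set containing the velocities used. -/
lemma smul_eulerCurve_sub_mem {A : Set E} (hA : Convex ℝ A) {s t : ℝ} (hh : 0 < h)
    (hlt : ⌊(s - t₀) / h⌋₊ < ⌊(t - t₀) / h⌋₊)
    (hmem : ∀ l : ℕ, ⌊(s - t₀) / h⌋₊ ≤ l → l < ⌊(t - t₀) / h⌋₊ →
      V (t₀ + l * h) (eulerNode V t₀ x₀ h l) ∈ A) :
    (((⌊(t - t₀) / h⌋₊ : ℝ) - ⌊(s - t₀) / h⌋₊) * h)⁻¹ •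
      (eulerCurve V t₀ x₀ h t - eulerCurve V t₀ x₀ h s) ∈ A := by
  rw [eulerCurve, eulerCurve, eulerNode_sub hlt.le, smul_smul, mul_inv, mul_assoc,
    inv_mul_cancel₀ hh.ne', mul_one, Finset.smul_sum]
  have hpos : (0 : ℝ) < (⌊(t - t₀) / h⌋₊ : ℝ) - ⌊(s - t₀) / h⌋₊ :=
    sub_pos.2 (by exact_mod_cast hlt)
  refine hA.sum_mem (fun _ _ => (inv_pos.2 hpos).le) ?_ fun l hl => ?_
  · rw [Finset.sum_const, Nat.card_Ico, nsmul_eq_mul, Nat.cast_sub hlt.le,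
      mul_inv_cancel₀ hpos.ne']
  · exact hmem l (Finset.mem_Ico.1 hl).1 (Finset.mem_Ico.1 hl).2

/-- Limits of Euler schemes aimed at `S` are viable in `S`, and their right difference quotients
are asymptotically admissible. -/
theorem exists_viable_lipschitz_curve [FiniteDimensional ℝ E] {S : Set (ℝ × E)}
    (hS : IsClosed S) {F : ℝ × E → Set E} {P : ℝ → E → ℝ × E} (hR : 0 ≤ R)
    (hV : ∀ τ y, ‖V τ y‖ ≤ R) (hP : ∀ τ y, P τ y ∈ S) (hVF : ∀ τ y, V τ y ∈ F (P τ y))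
    (hmin : ∀ τ y, ∀ q ∈ S, (τ - (P τ y).1) ^ 2 + ‖y - (P τ y).2‖ ^ 2 ≤
      (τ - q.1) ^ 2 + ‖y - q.2‖ ^ 2)
    (haim : ∀ τ y, (τ - (P τ y).1) + ⟪V τ y, y - (P τ y).2⟫ ≤ 0)
    (hconv : ∀ q, Convex ℝ (F q))
    (husc : ∀ q, ∀ ε > 0, ∃ δ > 0, ∀ q' ∈ S, |q'.1 - q.1| ≤ δ → ‖q'.2 - q.2‖ ≤ δ →
      F q' ⊆ cthickening ε (F q))
    (h₀ : (t₀, x₀) ∈ S) :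
    ∃ x : ℝ → E, LipschitzWith R.toNNReal x ∧ x t₀ = x₀ ∧ ∀ t, t₀ ≤ t → (t, x t) ∈ S ∧
      ∀ ε > 0, ∀ᶠ η in 𝓝[>] (0 : ℝ), η⁻¹ • (x (t + η) - x t) ∈ cthickening ε (F (t, x t)) := by
  have := FiniteDimensional.proper_real E
  set U : Ultrafilter ℕ := hyperfilter ℕ
  have hU : (U : Filter ℕ) ≤ atTop := by
    rw [← Nat.cofinite_eq_atTop]; exact hyperfilter_le_cofinite
  set st : ℕ → ℝ := fun k => 1 / ((k : ℝ) + 1) with hst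
  have hpos : ∀ k, 0 < st k := fun k => by positivity
  have hst1 : ∀ k, st k ≤ 1 := fun k => by
    rw [hst]
    exact div_le_one_of_le₀ (by linarith [Nat.cast_nonneg (α := ℝ) k]) (by positivity)
  have hst0 : Tendsto st U (𝓝 0) := (tendsto_one_div_add_atTop_nhds_zero_nat (𝕜 := ℝ)).mono_left hU
  set X : ℕ → ℝ → E := fun k => eulerCurve V t₀ x₀ (st k) with hX
  have hXlip : ∀ k s t, ‖X k t - X k s‖ ≤ R * (|t - s| + st k) := fun k s t =>
    norm_eulerCurve_sub_le hV hR (hpos k) s t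
  have hlim : ∀ t, ∃ y, Tendsto (fun k => X k t) U (𝓝 y) := by
    intro t
    obtain ⟨y, -, hy⟩ := (isCompact_closedBall x₀ (R * (|t - t₀| + 1))).ultrafilter_le_nhds
      (U.map fun k => X k t) (by
        rw [le_principal_iff]
        refine eventually_map.2 (Eventually.of_forall fun k => ?_)
        rw [dist_eq_norm]
        have := hXlip k t₀ t
        rw [show X k t₀ = x₀ from eulerCurve_self] at this
        exact this.trans (by gcongr; exact hst1 k))
    exact ⟨y, hy⟩
  choose x hx using hlim
  have hsqrt : ∀ c : ℝ, Tendsto (fun k => √(c * (st k * (1 + R ^ 2)))) U (𝓝 0) := by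
    intro c
    have h1 : Continuous fun z : ℝ => √(c * (z * (1 + R ^ 2))) := by fun_prop
    simpa [Function.comp_def] using (h1.tendsto 0).comp hst0
  -- distance from an Euler node to the set, up to a given time
  have hnode : ∀ (k l : ℕ) (c : ℝ), l * st k ≤ c →
      |t₀ + l * st k - (P (t₀ + l * st k) (eulerNode V t₀ x₀ (st k) l)).1| ≤
        √(c * (st k * (1 + R ^ 2))) ∧
      ‖eulerNode V t₀ x₀ (st k) l - (P (t₀ + l * st k) (eulerNode V t₀ x₀ (st k) l)).2‖ ≤
        √(c * (st k * (1 + R ^ 2))) := by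
    intro k l c hc
    have h1 := sq_dist_eulerNode_le hV hP hmin haim h₀ (hpos k).le l
    have h2 : l * st k * (st k * (1 + R ^ 2)) ≤ c * (st k * (1 + R ^ 2)) := by
      have := hpos k
      gcongr
    refine ⟨Real.abs_le_sqrt ?_, Real.le_sqrt_of_sq_le ?_⟩
    · linarith [sq_nonneg ‖eulerNode V t₀ x₀ (st k) l -
        (P (t₀ + l * st k) (eulerNode V t₀ x₀ (st k) l)).2‖]
    · linarith [sq_nonneg (t₀ + l * st k - (P (t₀ + l * st k) (eulerNode V t₀ x₀ (st k) l)).1)]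
  have hfl : ∀ t, t₀ ≤ t → ∀ k, (⌊(t - t₀) / st k⌋₊ : ℝ) * st k ≤ t - t₀ := fun t ht k =>
    (le_div_iff₀ (hpos k)).1 (Nat.floor_le (div_nonneg (sub_nonneg.2 ht) (hpos k).le))
  have htime : ∀ t, t₀ ≤ t → Tendsto (fun k => t₀ + (⌊(t - t₀) / st k⌋₊ : ℝ) * st k) U (𝓝 t) :=
    fun t ht => tendsto_iff_norm_sub_tendsto_zero.2 <|
      squeeze_zero (fun _ => norm_nonneg _) (fun k => abs_add_floor_mul_sub_le (hpos k) ht) hst0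
  refine ⟨x, LipschitzWith.of_dist_le_mul fun s t => ?_, ?_, fun t ht => ⟨?_, fun ε hε => ?_⟩⟩
  · rw [Real.coe_toNNReal _ hR, dist_eq_norm, Real.dist_eq]
    have h1 : Tendsto (fun k => R * (|s - t| + st k)) U (𝓝 (R * (|s - t| + 0))) :=
      (hst0.const_add _).const_mul _
    rw [add_zero] at h1
    exact le_of_tendsto_of_tendsto' ((hx s).sub (hx t)).norm h1 fun k => hXlip k t s
  · refine tendsto_nhds_unique (hx t₀) ?_
    simp only [hX, eulerCurve_self]
    exact tendsto_const_nhds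
  · set Q : ℕ → ℝ × E := fun k => P (t₀ + (⌊(t - t₀) / st k⌋₊ : ℝ) * st k) (X k t) with hQ
    have hd := fun k => hnode k _ (t - t₀) (hfl t ht k)
    have h1 : Tendsto (fun k => (Q k).1) U (𝓝 t) := by
      have := (htime t ht).sub (squeeze_zero_norm (fun k => (hd k).1) (hsqrt (t - t₀)))
      simpa [hQ, hX, eulerCurve] using this
    have h2 : Tendsto (fun k => (Q k).2) U (𝓝 (x t)) := by
      have := (hx t).sub (squeeze_zero_norm (fun k => (hd k).2) (hsqrt (t - t₀)))
      simpa [hQ, hX, eulerCurve] using this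
    exact hS.mem_of_tendsto (h1.prodMk_nhds h2) (Eventually.of_forall fun k => hP _ _)
  · obtain ⟨δ, hδ, hsub⟩ := husc (t, x t) ε hε
    have hsmall : ∀ᶠ η in 𝓝[>] (0 : ℝ), (1 + R) * η < δ := by
      have h1 : Tendsto (fun η : ℝ => (1 + R) * η) (𝓝[>] 0) (𝓝 ((1 + R) * 0)) :=
        (Continuous.tendsto (by fun_prop) 0).mono_left nhdsWithin_le_nhds
      rw [mul_zero] at h1
      exact h1.eventually (gt_mem_nhds hδ)
    filter_upwards [hsmall, self_mem_nhdsWithin] with η hη (hη0 : 0 < η)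
    have ht' : t₀ ≤ t + η := by linarith
    have hden : Tendsto (fun k => ((⌊(t + η - t₀) / st k⌋₊ : ℝ) - ⌊(t - t₀) / st k⌋₊) * st k) U
        (𝓝 η) := by
      have := (htime (t + η) ht').sub (htime t ht)
      rw [add_sub_cancel_left] at this
      refine this.congr fun k => ?_
      ring
    refine isClosed_cthickening.mem_of_tendsto
      ((hden.inv₀ hη0.ne').smul ((hx (t + η)).sub (hx t))) ?_
    have herr : Tendsto (fun k => √((t + η - t₀) * (st k * (1 + R ^ 2))) + (1 + R) * (η + st k) +
        ‖X k t - x t‖) U (𝓝 (0 + (1 + R) * (η + 0) + 0)) :=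
      ((hsqrt _).add ((hst0.const_add η).const_mul _)).add
        (tendsto_iff_norm_sub_tendsto_zero.1 (hx t))
    rw [zero_add, add_zero, add_zero] at herr
    filter_upwards [herr.eventually (gt_mem_nhds hη), hden.eventually (lt_mem_nhds hη0)]
      with k hk hdk
    have hhk := hpos k
    have hlt : ⌊(t - t₀) / st k⌋₊ < ⌊(t + η - t₀) / st k⌋₊ := by
      have := pos_of_mul_pos_left hdk hhk.le
      exact_mod_cast sub_pos.1 this
    refine smul_eulerCurve_sub_mem ((hconv _).cthickening ε) hhk hlt fun l hl1 hl2 => ?_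
    have hlt' : (l : ℝ) * st k ≤ t + η - t₀ :=
      (mul_le_mul_of_nonneg_right (by exact_mod_cast hl2.le) hhk.le).trans (hfl _ ht' k)
    have hll : ((l : ℝ) - ⌊(t - t₀) / st k⌋₊) * st k ≤ η + st k := by
      have h1 := (abs_le.1 (abs_add_floor_mul_sub_le hhk ht)).1
      linarith
    have hlow : t - st k ≤ t₀ + l * st k := by
      have h1 := (abs_le.1 (abs_add_floor_mul_sub_le hhk ht)).1
      have h2 : (⌊(t - t₀) / st k⌋₊ : ℝ) * st k ≤ l * st k := by
        gcongr
      linarith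
    obtain ⟨hd1, hd2⟩ := hnode k l _ hlt'
    have hnl := (norm_eulerNode_sub_le (t₀ := t₀) (x₀ := x₀) hV hhk.le hl1).trans
      (mul_le_mul_of_nonneg_left hll hR)
    refine hsub _ (hP _ _) ?_ ?_ (hVF _ _)
    · have h1 : |t₀ + l * st k - t| ≤ η + st k := by
        rw [abs_le]; constructor <;> linarith
      have h2 := abs_sub_le (P (t₀ + l * st k) (eulerNode V t₀ x₀ (st k) l)).1 (t₀ + l * st k) t
      rw [abs_sub_comm] at hd1
      have h3 : 0 ≤ R * (η + st k) := by positivity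
      linarith [norm_nonneg (X k t - x t)]
    · set y := eulerNode V t₀ x₀ (st k) l
      set q := (P (t₀ + l * st k) y).2
      have h1 : ‖q - x t‖ ≤ ‖y - q‖ + ‖y - X k t‖ + ‖X k t - x t‖ := by
        calc ‖q - x t‖ = ‖-(y - q) + (y - X k t) + (X k t - x t)‖ := by congr 1; abel
          _ ≤ ‖-(y - q)‖ + ‖y - X k t‖ + ‖X k t - x t‖ := norm_add₃_le
          _ = _ := by rw [norm_neg]
      have h2 : ‖y - X k t‖ ≤ R * (η + st k) := hnl
      have h3 : 0 ≤ η + st k := by positivity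
      linarith

end Euler

/-- The displacement to a nearest point is a proximal normal. -/
lemma mem_proxNormalCone2_of_forall_le {S : Set (ℝ × E)} {τ : ℝ} {y : E} {q : ℝ × E}
    (hq : q ∈ S) (hmin : ∀ q' ∈ S, (τ - q.1) ^ 2 + ‖y - q.2‖ ^ 2 ≤
      (τ - q'.1) ^ 2 + ‖y - q'.2‖ ^ 2) :
    (τ - q.1, y - q.2) ∈ proxNormalCone2 S q := by
  refine ⟨hq, 1 / 2, by norm_num, fun q' hq' => ?_⟩
  have h := hmin q' hq'
  have h2 : ‖y - q'.2‖ ^ 2 = ‖y - q.2‖ ^ 2 - 2 * ⟪y - q.2, q'.2 - q.2⟫ + ‖q'.2 - q.2‖ ^ 2 := by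
    rw [← norm_sub_sq_real]
    congr 2
    abel
  rw [h2] at h
  dsimp only
  nlinarith

lemma IsClosed.exists_forall_sq_add_norm_sq_le [FiniteDimensional ℝ E] {S : Set (ℝ × E)}
    (hS : IsClosed S) (hne : S.Nonempty) (τ : ℝ) (y : E) :
    ∃ q ∈ S, ∀ q' ∈ S, (τ - q.1) ^ 2 + ‖y - q.2‖ ^ 2 ≤ (τ - q'.1) ^ 2 + ‖y - q'.2‖ ^ 2 := by
  have := FiniteDimensional.proper_real E
  have hS' : IsClosed ((WithLp.ofLp : WithLp 2 (ℝ × E) → ℝ × E) ⁻¹' S) :=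
    hS.preimage (WithLp.prod_continuous_ofLp 2 ℝ E)
  obtain ⟨q₀, hq₀⟩ := hne
  obtain ⟨q, hq, hmin⟩ := hS'.exists_infDist_eq_dist ⟨WithLp.toLp 2 q₀, hq₀⟩
    (WithLp.toLp 2 (τ, y))
  refine ⟨q.ofLp, hq, fun q' hq' => ?_⟩
  have h := (hmin.symm.trans_le (infDist_le_dist_of_mem (y := WithLp.toLp 2 q') hq'))
  rw [WithLp.prod_dist_eq_of_L2, WithLp.prod_dist_eq_of_L2] at h
  have h' := Real.sqrt_le_sqrt_iff (by positivity) |>.1 h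
  simpa [dist_eq_norm, Real.dist_eq, sq_abs] using h'

section sweeping

variable [FiniteDimensional ℝ E] {r L_C M L_G R : ℝ} {C : ℝ → Set E} {G : ℝ → E → Set E}

/-- Both minima in the Hamiltonian are attained, so some truncated velocity points inwards. -/
lemma exists_truncatedVelocity_add_inner_le (hr : 0 < r) (hC : HypC r L_C C)
    (hG : HypG M L_G G) (hR : 0 ≤ R) {t : ℝ} {x : E} (ht : 0 ≤ t) (hx : x ∈ C t) {p : ℝ × E}
    (h : sInf {a : ℝ | ∃ ξ ∈ proxNormalCone (C t) x, ‖ξ‖ ≤ R ∧ a = ⟪-ξ, p.2⟫} +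
      sInf {a : ℝ | ∃ g ∈ G t x, a = p.1 + ⟪g, p.2⟫} ≤ 0) :
    ∃ v ∈ truncatedVelocity R C G t x, p.1 + ⟪v, p.2⟫ ≤ 0 := by
  have h1 := ((isCompact_proxNormalCone_inter (R := R) hr hC ht x).image
    (f := fun ξ : E => ⟪-ξ, p.2⟫) (by fun_prop)).sInf_mem
    (Set.Nonempty.image _ ⟨0, zero_mem_proxNormalCone hx, by simpa using hR⟩)
  have h2 := ((hG.isCompact t x).image (f := fun g : E => p.1 + ⟪g, p.2⟫) (by fun_prop)).sInf_mem
    ((hG.nonempty t x).image _)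
  obtain ⟨ξ, ⟨hξ, hξR⟩, hξe⟩ := h1
  obtain ⟨g, hg, hge⟩ := h2
  refine ⟨-ξ + g, ⟨ξ, hξ, hξR, g, hg, rfl⟩, ?_⟩
  have e1 : {a : ℝ | ∃ ξ ∈ proxNormalCone (C t) x, ‖ξ‖ ≤ R ∧ a = ⟪-ξ, p.2⟫} =
      (fun ξ : E => ⟪-ξ, p.2⟫) '' {ξ | ξ ∈ proxNormalCone (C t) x ∧ ‖ξ‖ ≤ R} := by
    ext a
    simp [and_assoc, eq_comm]
  have e2 : {a : ℝ | ∃ g ∈ G t x, a = p.1 + ⟪g, p.2⟫} =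
      (fun g : E => p.1 + ⟪g, p.2⟫) '' G t x := by
    ext a
    simp [eq_comm]
  rw [e1, e2, ← hξe, ← hge] at h
  rw [inner_add_left]
  dsimp only at h
  linarith

/-- A Lipschitz curve whose right difference quotients approach the truncated velocities solves
the sweeping process. -/
lemma isSweepingSol_of_lipschitzWith (hr : 0 < r) (hC : HypC r L_C C) (hG : HypG M L_G G)
    {t₀ : ℝ} (ht₀ : 0 ≤ t₀) (T : ℝ) {k : NNReal} {x : ℝ → E} (hx : LipschitzWith k x)
    (hmem : ∀ t, t₀ ≤ t → x t ∈ C t)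
    (hvel : ∀ t, t₀ ≤ t → ∀ ε > 0, ∀ᶠ η in 𝓝[>] (0 : ℝ),
      η⁻¹ • (x (t + η) - x t) ∈ cthickening ε (truncatedVelocity R C G t (x t))) :
    IsSweepingSol C G t₀ T x := by
  have hloc : LocallyIntegrable (deriv x) :=
    (locallyIntegrable_const (k : ℝ)).mono (stronglyMeasurable_deriv x).aestronglyMeasurable
      (Eventually.of_forall fun s => by simpa using norm_deriv_le_of_lipschitz hx)
  refine ⟨fun t ht => hmem t ht.1, deriv x, hloc.integrableOn_isCompact isCompact_Icc,
    fun t _ => by rw [hx.intervalIntegral_deriv_eq_sub]; abel, ?_⟩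
  filter_upwards [ae_restrict_of_ae hx.ae_differentiableAt_real,
    ae_restrict_mem measurableSet_Icc] with t hd ht
  have hslope : Tendsto (fun η : ℝ => η⁻¹ • (x (t + η) - x t)) (𝓝[>] 0) (𝓝 (deriv x t)) :=
    hd.hasDerivAt.tendsto_slope_zero_right
  have hcl : deriv x t ∈ closure (truncatedVelocity R C G t (x t)) := by
    rw [closure_eq_iInter_cthickening]
    simp only [mem_iInter]
    exact fun ε hε => isClosed_cthickening.mem_of_tendsto hslope (hvel t ht.1 ε hε)
  rw [(isCompact_truncatedVelocity hr hC hG (ht₀.trans ht.1) _).isClosed.closure_eq] at hcl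
  obtain ⟨ξ, hξ, -, g, hg, hv⟩ := hcl
  rw [hv]
  exact Set.add_mem_add (Set.neg_mem_neg.2 hξ) hg

/-- If the Hamiltonian inequality holds along the proximal normals of the constraint graph, then
viable solutions exist. -/
theorem exists_isSweepingSol_of_sInf_add_sInf_nonpos (hr : 0 < r) (hC : HypC r L_C C)
    (hG : HypG M L_G G) (hR : 0 ≤ R) {K : Set E} (hK : IsClosed K)
    (h : ∀ t x, 0 ≤ t → x ∈ C t ∩ K →
      ∀ p ∈ proxNormalCone2 {q : ℝ × E | 0 ≤ q.1 ∧ q.2 ∈ C q.1 ∩ K} (t, x),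
        sInf {a : ℝ | ∃ ξ ∈ proxNormalCone (C t) x, ‖ξ‖ ≤ R ∧ a = ⟪-ξ, p.2⟫} +
          sInf {a : ℝ | ∃ g ∈ G t x, a = p.1 + ⟪g, p.2⟫} ≤ 0)
    {t₀ : ℝ} {x₀ : E} (ht₀ : 0 ≤ t₀) (hx₀ : x₀ ∈ C t₀ ∩ K) (T : ℝ) :
    ∃ x : ℝ → E, IsSweepingSol C G t₀ T x ∧ x t₀ = x₀ ∧ ∀ t, t₀ ≤ t → x t ∈ K := by
  set S : Set (ℝ × E) := {q | 0 ≤ q.1 ∧ q.2 ∈ C q.1 ∩ K} with hSdef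
  have hS : IsClosed S := by
    refine IsSeqClosed.isClosed fun q q' hq hlim => ?_
    have h1 := (continuous_fst.tendsto q').comp hlim
    have h2 := (continuous_snd.tendsto q').comp hlim
    exact ⟨ge_of_tendsto' h1 fun i => (hq i).1,
      hC.mem_of_tendsto (fun i => (hq i).1) (fun i => (hq i).2.1) h1 h2,
      hK.mem_of_tendsto h2 (Eventually.of_forall fun i => (hq i).2.2)⟩
  choose P hP hmin using hS.exists_forall_sq_add_norm_sq_le ⟨(t₀, x₀), ht₀, hx₀⟩
  have hsel (τ : ℝ) (y : E) : ∃ v ∈ truncatedVelocity R C G (P τ y).1 (P τ y).2,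
      (τ - (P τ y).1) + ⟪v, y - (P τ y).2⟫ ≤ 0 :=
    exists_truncatedVelocity_add_inner_le hr hC hG hR (p := (τ - (P τ y).1, y - (P τ y).2))
      (hP τ y).1 (hP τ y).2.1
      (h _ _ (hP τ y).1 (hP τ y).2 _ (mem_proxNormalCone2_of_forall_le (hP τ y) (hmin τ y)))
  choose V hV haim using hsel
  obtain ⟨x, hxL, hx0, hx⟩ := exists_viable_lipschitz_curve hS
    (F := fun q => truncatedVelocity R C G q.1 q.2) (add_nonneg hR hG.bound_nonneg)
    (fun τ y => norm_le_of_mem_truncatedVelocity hG (hV τ y)) hP hV hmin haim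
    (fun q => convex_truncatedVelocity hG _ _)
    (fun q ε hε => by
      obtain ⟨δ, hδ, hsub⟩ :=
        exists_truncatedVelocity_subset_cthickening (R := R) hr hC hG q.1 q.2 hε
      exact ⟨δ, hδ, fun q' hq' h1 h2 => hsub _ _ hq'.1 h1 h2⟩)
    (show (t₀, x₀) ∈ S from ⟨ht₀, hx₀⟩)
  exact ⟨x, isSweepingSol_of_lipschitzWith hr hC hG ht₀ T hxL (fun t ht => (hx t ht).1.2.1)
    (fun t ht => (hx t ht).2), hx0, fun t ht => (hx t ht).1.2.2⟩

end sweeping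

/-- Hamiltonian characterisation of weak invariance for the perturbed
sweeping process. -/
theorem weak_invariance_iff {n : ℕ} (r L_C M L_G : ℝ) (hr : 0 < r)
    (C : ℝ → Set (EuclideanSpace ℝ (Fin n)))
    (G : ℝ → EuclideanSpace ℝ (Fin n) → Set (EuclideanSpace ℝ (Fin n)))
    (hC : HypC r L_C C) (hG : HypG M L_G G)
    (K : Set (EuclideanSpace ℝ (Fin n))) (hK : IsClosed K)
    (hKC : ∀ t, 0 ≤ t → (C t ∩ K).Nonempty) :
    -- (a) weak invariance
    (∀ t₀ x₀, 0 ≤ t₀ → x₀ ∈ C t₀ ∩ K →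
      ∃ T > t₀, ∃ x : ℝ → EuclideanSpace ℝ (Fin n),
        IsSweepingSol C G t₀ T x ∧ x t₀ = x₀ ∧ ∀ t ∈ Ico t₀ T, x t ∈ K)
    ↔
    -- (b) Hamiltonian inequality
    (∀ t x, 0 ≤ t → x ∈ C t ∩ K →
      ∀ p ∈ proxNormalCone2 {q : ℝ × EuclideanSpace ℝ (Fin n) |
          0 ≤ q.1 ∧ q.2 ∈ C q.1 ∩ K} (t, x),
        sInf {a : ℝ | ∃ ξ ∈ proxNormalCone (C t) x, ‖ξ‖ ≤ L_C + M ∧ a = ⟪-ξ, p.2⟫} +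
          sInf {a : ℝ | ∃ g ∈ G t x, a = p.1 + ⟪g, p.2⟫} ≤ 0) := by
  constructor
  · intro h t x ht hx p hp
    obtain ⟨T, hT, y, hy, rfl, hyK⟩ := h t x ht hx
    refine hy.sInf_add_sInf_nonpos hr hC hG ht hT (fun s hs => ?_) hp
    exact ⟨ht.trans hs.1, hy.1 s (Ico_subset_Icc_self hs), hyK s hs⟩
  · intro h t₀ x₀ ht₀ hx₀
    obtain ⟨x, hx, hx0, hxK⟩ := exists_isSweepingSol_of_sInf_add_sInf_nonpos hr hC hG
      (add_nonneg hC.lipschitz_const_nonneg hG.bound_nonneg) hK h ht₀ hx₀ (t₀ + 1)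
    exact ⟨t₀ + 1, by linarith, x, hx, hx0, fun t ht => hxK t ht.1⟩
end

section
/- Assume Hypothesis (H_C), let L > 0, and let g : [0,∞) × ℝⁿ → ℝⁿ satisfy ‖g(t,x) − g(t,y)‖ ≤ L_g ‖x − y‖ for all t, x, y. Let y₁, y₂ : [t₀,T] → ℝⁿ be absolutely continuous with yᵢ(t) ∈ C(t) for all t and ẏᵢ(t) ∈ −(N_{C(t)}(yᵢ(t)) ∩ L𝔹̄) + g(t, yᵢ(t)) for a.e. t ∈ [t₀,T]. Then for all t ∈ [t₀,T], ‖y₁(t) − y₂(t)‖ ≤ e^{(L/r + L_g)(t − t₀)} ‖y₁(t₀) − y₂(t₀)‖. -/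
open scoped Pointwise RealInnerProductSpace ENNReal
open Set Metric MeasureTheory

variable {E : Type*} [NormedAddCommGroup E] [InnerProductSpace ℝ E]

/-- A map whose increments are controlled by those of an absolutely continuous map is
absolutely continuous. -/
theorem AbsolutelyContinuousOnInterval.of_dist_le {X Y : Type*} [PseudoMetricSpace X]
    [PseudoMetricSpace Y] {f : ℝ → X} {p : ℝ → Y} {a b K : ℝ}
    (hp : AbsolutelyContinuousOnInterval p a b)
    (h : ∀ x ∈ uIcc a b, ∀ y ∈ uIcc a b, dist (f x) (f y) ≤ K * dist (p x) (p y)) :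
    AbsolutelyContinuousOnInterval f a b := by
  have hK : Filter.Tendsto (fun I : ℕ × (ℕ → ℝ × ℝ) =>
      K * ∑ i ∈ Finset.range I.1, dist (p (I.2 i).1) (p (I.2 i).2))
      (AbsolutelyContinuousOnInterval.totalLengthFilter ⊓
        Filter.principal (AbsolutelyContinuousOnInterval.disjWithin a b)) (nhds 0) := by
    simpa using Filter.Tendsto.const_mul K hp
  refine squeeze_zero' (Filter.Eventually.of_forall fun I =>
    Finset.sum_nonneg fun i _ => dist_nonneg) ?_ hK
  filter_upwards [Filter.mem_inf_of_right (Filter.mem_principal_self _)] with I hI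
  rw [Finset.mul_sum]
  exact Finset.sum_le_sum fun i hi => h _ (hI.1 i hi).1 _ (hI.1 i hi).2

section Gronwall

variable {F : Type*} [NormedAddCommGroup F]

/-- The primitive of an integrable vector-valued function is absolutely continuous. -/
theorem absolutelyContinuousOnInterval_const_add_integral [NormedSpace ℝ F]
    {u : ℝ → F} {a b : ℝ} (hu : IntervalIntegrable u volume a b) (c : F) :
    AbsolutelyContinuousOnInterval (fun t => c + ∫ s in a..t, u s) a b := by
  refine (hu.norm.absolutelyContinuousOnInterval_intervalIntegral left_mem_uIcc).of_dist_le
    (K := 1) fun x hx y hy => ?_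
  have hsub : ∀ z ∈ uIcc a b, IntervalIntegrable u volume a z := fun z hz =>
    hu.mono_set (uIcc_subset_uIcc_left hz)
  rw [dist_add_left, dist_eq_norm, Real.dist_eq, one_mul,
    intervalIntegral.integral_interval_sub_left (hsub x hx) (hsub y hy),
    intervalIntegral.integral_interval_sub_left (hsub x hx).norm (hsub y hy).norm]
  exact intervalIntegral.norm_integral_le_abs_integral_norm

/-- The squared norm of an absolutely continuous map is absolutely continuous. -/
theorem AbsolutelyContinuousOnInterval.norm_sq {f : ℝ → F} {a b : ℝ}
    (hf : AbsolutelyContinuousOnInterval f a b) :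
    AbsolutelyContinuousOnInterval (fun t => ‖f t‖ ^ 2) a b := by
  have hn : AbsolutelyContinuousOnInterval (fun t => ‖f t‖) a b :=
    hf.of_dist_le (K := 1) fun x _ y _ => by
      simpa [Real.dist_eq, dist_eq_norm] using abs_norm_sub_norm_le (f x) (f y)
  simpa [pow_two, Pi.mul_def] using hn.mul hn

/-- Gronwall's inequality for absolutely continuous curves in a Hilbert space satisfying a
one-sided differential inequality almost everywhere. -/
theorem norm_le_exp_mul_norm_of_ae_inner_le [InnerProductSpace ℝ F] [CompleteSpace F]
    {v u : ℝ → F} {a b K : ℝ} (hab : a ≤ b) (hu : IntervalIntegrable u volume a b)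
    (hv : ∀ t ∈ Icc a b, v t = v a + ∫ s in a..t, u s)
    (h : ∀ᵐ t, t ∈ Icc a b → ⟪v t, u t⟫ ≤ K * ‖v t‖ ^ 2) :
    ‖v b‖ ≤ Real.exp (K * (b - a)) * ‖v a‖ := by
  set w : ℝ → F := fun t => v a + ∫ s in a..t, u s with hw
  set e : ℝ → ℝ := fun t => Real.exp (-(2 * K) * (t - a)) with he
  have hwac : AbsolutelyContinuousOnInterval w a b :=
    absolutelyContinuousOnInterval_const_add_integral hu _
  have heac : AbsolutelyContinuousOnInterval e a b :=
    ContDiffOn.absolutelyContinuousOnInterval (ContDiff.contDiffOn (by fun_prop))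
  have hftc := (heac.mul hwac.norm_sq).integral_deriv_eq_sub
  have hderiv : ∀ᵐ t, t ∈ Ioc a b → deriv (e * fun t => ‖w t‖ ^ 2) t ≤ 0 := by
    filter_upwards [h, hu.ae_hasDerivAt_integral] with t ht hdt hmem
    have htI : t ∈ Icc a b := Ioc_subset_Icc_self hmem
    rw [uIcc_of_le hab] at hdt
    have hwd : HasDerivAt w (u t) t := (hdt htI a (left_mem_Icc.2 hab)).const_add (v a)
    have hed : HasDerivAt e (e t * (-(2 * K) * 1)) t :=
      (((hasDerivAt_id t).sub_const a).const_mul (-(2 * K))).exp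
    rw [(hed.mul hwd.norm_sq).deriv]
    have hvw : v t = w t := hv t htI
    have hle := ht htI
    rw [hvw] at hle
    have := mul_nonneg (Real.exp_pos (-(2 * K) * (t - a))).le (sub_nonneg.2 hle)
    simp only [he]
    nlinarith
  have hnonpos : ∫ t in a..b, deriv (e * fun t => ‖w t‖ ^ 2) t ≤ 0 := by
    rw [intervalIntegral.integral_of_le hab]
    exact integral_nonpos_of_ae ((ae_restrict_iff' measurableSet_Ioc).2 hderiv)
  have hwb : w b = v b := (hv b (right_mem_Icc.2 hab)).symm
  have hwa : w a = v a := by simp [hw]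
  have hea : e a = 1 := by simp [he]
  rw [hftc] at hnonpos
  simp only [Pi.mul_apply, hwb, hwa, hea, one_mul] at hnonpos
  have hsq : ‖v b‖ ^ 2 ≤ (Real.exp (K * (b - a)) * ‖v a‖) ^ 2 := by
    have hinv : Real.exp (K * (b - a)) ^ 2 * e b = 1 := by
      rw [he, ← Real.exp_nat_mul, ← Real.exp_add, ← Real.exp_zero]
      congr 1
      push_cast
      ring
    calc ‖v b‖ ^ 2 = Real.exp (K * (b - a)) ^ 2 * (e b * ‖v b‖ ^ 2) := by
          rw [← mul_assoc, hinv, one_mul]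
      _ ≤ Real.exp (K * (b - a)) ^ 2 * ‖v a‖ ^ 2 := by gcongr; linarith
      _ = _ := by ring
  exact le_of_sq_le_sq hsq (by positivity)

end Gronwall

/-- Truncated normals to a prox-regular set are hypomonotone. -/
theorem ProxRegular.inner_sub_le {r L : ℝ} {K : Set E} (hK : ProxRegular r K) (hr : 0 < r)
    {x y ζ ξ : E} (hζ : ζ ∈ proxNormalCone K x) (hξ : ξ ∈ proxNormalCone K y)
    (hζL : ‖ζ‖ ≤ L) (hξL : ‖ξ‖ ≤ L) :
    ⟪x - y, ξ - ζ⟫ ≤ L / r * ‖x - y‖ ^ 2 := by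
  have h₁ := hK x hζ.1 y hξ.1 ζ hζ
  have h₂ := hK y hξ.1 x hζ.1 ξ hξ
  have bound : ∀ c : ℝ, c ≤ L →
      1 / (2 * r) * c * ‖x - y‖ ^ 2 ≤ 1 / (2 * r) * L * ‖x - y‖ ^ 2 := fun c hc => by gcongr
  have hsum : ⟪x - y, ξ - ζ⟫ = ⟪ζ, y - x⟫ + ⟪ξ, x - y⟫ := by
    rw [inner_sub_right, real_inner_comm, real_inner_comm ζ (x - y), ← neg_sub x y,
      inner_neg_right]
    ring
  rw [norm_sub_rev] at h₁
  calc ⟪x - y, ξ - ζ⟫ ≤ 1 / (2 * r) * L * ‖x - y‖ ^ 2 + 1 / (2 * r) * L * ‖x - y‖ ^ 2 := by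
        linarith [bound _ hζL, bound _ hξL]
    _ = L / r * ‖x - y‖ ^ 2 := by field_simp; ring

/-- Gronwall-type estimate for two solutions of the truncated sweeping process
with a Lipschitz-in-space single-valued perturbation `g`. -/
theorem sweeping_gronwall_estimate {n : ℕ} (r L_C L L_g : ℝ) (hr : 0 < r) (hL : 0 < L)
    (C : ℝ → Set (EuclideanSpace ℝ (Fin n))) (hC : HypC r L_C C)
    (g : ℝ → EuclideanSpace ℝ (Fin n) → EuclideanSpace ℝ (Fin n))
    (hg : ∀ t x y, ‖g t x - g t y‖ ≤ L_g * ‖x - y‖)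
    (t0 T : ℝ) (ht0 : 0 ≤ t0)
    (y₁ y₂ : ℝ → EuclideanSpace ℝ (Fin n))
    (hmem₁ : ∀ t ∈ Icc t0 T, y₁ t ∈ C t)
    (hmem₂ : ∀ t ∈ Icc t0 T, y₂ t ∈ C t)
    (hsol₁ : ∃ y' : ℝ → EuclideanSpace ℝ (Fin n), IntegrableOn y' (Icc t0 T) ∧
      (∀ t ∈ Icc t0 T, y₁ t = y₁ t0 + ∫ s in t0..t, y' s) ∧
      ∀ᵐ t ∂(volume.restrict (Icc t0 T)),
        y' t ∈ -(proxNormalCone (C t) (y₁ t) ∩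
          closedBall (0 : EuclideanSpace ℝ (Fin n)) L) + {g t (y₁ t)})
    (hsol₂ : ∃ y' : ℝ → EuclideanSpace ℝ (Fin n), IntegrableOn y' (Icc t0 T) ∧
      (∀ t ∈ Icc t0 T, y₂ t = y₂ t0 + ∫ s in t0..t, y' s) ∧
      ∀ᵐ t ∂(volume.restrict (Icc t0 T)),
        y' t ∈ -(proxNormalCone (C t) (y₂ t) ∩
          closedBall (0 : EuclideanSpace ℝ (Fin n)) L) + {g t (y₂ t)}) :
    ∀ t ∈ Icc t0 T,
      ‖y₁ t - y₂ t‖ ≤ Real.exp ((L / r + L_g) * (t - t0)) * ‖y₁ t0 - y₂ t0‖ := by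
  obtain ⟨u₁, hu₁, hy₁, hd₁⟩ := hsol₁
  obtain ⟨u₂, hu₂, hy₂, hd₂⟩ := hsol₂
  intro t ht
  have hsub : Icc t0 t ⊆ Icc t0 T := Icc_subset_Icc_right ht.2
  have hi₁ : ∀ s ∈ Icc t0 t, IntervalIntegrable u₁ volume t0 s := fun s hs =>
    (intervalIntegrable_iff_integrableOn_Icc_of_le hs.1).2
      (hu₁.mono_set (Icc_subset_Icc_right (hsub hs).2))
  have hi₂ : ∀ s ∈ Icc t0 t, IntervalIntegrable u₂ volume t0 s := fun s hs =>
    (intervalIntegrable_iff_integrableOn_Icc_of_le hs.1).2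
      (hu₂.mono_set (Icc_subset_Icc_right (hsub hs).2))
  have htt : t ∈ Icc t0 t := right_mem_Icc.2 ht.1
  refine norm_le_exp_mul_norm_of_ae_inner_le (v := fun s => y₁ s - y₂ s)
    (u := fun s => u₁ s - u₂ s) ht.1 ((hi₁ t htt).sub (hi₂ t htt)) (fun s hs => ?_) ?_
  · simp only [intervalIntegral.integral_sub (hi₁ s hs) (hi₂ s hs)]
    rw [hy₁ s (hsub hs), hy₂ s (hsub hs)]
    abel
  · rw [ae_restrict_iff' measurableSet_Icc] at hd₁ hd₂
    filter_upwards [hd₁, hd₂] with s hs₁ hs₂ hs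
    obtain ⟨a₁, ⟨hN₁, hB₁⟩, b₁, rfl, hab₁⟩ := hs₁ (hsub hs)
    obtain ⟨a₂, ⟨hN₂, hB₂⟩, b₂, rfl, hab₂⟩ := hs₂ (hsub hs)
    rw [mem_closedBall_zero_iff] at hB₁ hB₂
    have hmono := (hC.proxRegular s (ht0.trans hs.1)).inner_sub_le hr hN₁ hN₂ hB₁ hB₂
    have hlip : ⟪y₁ s - y₂ s, g s (y₁ s) - g s (y₂ s)⟫ ≤ L_g * ‖y₁ s - y₂ s‖ ^ 2 := by
      calc _ ≤ ‖y₁ s - y₂ s‖ * ‖g s (y₁ s) - g s (y₂ s)‖ := real_inner_le_norm _ _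
        _ ≤ ‖y₁ s - y₂ s‖ * (L_g * ‖y₁ s - y₂ s‖) := by gcongr; exact hg s _ _
        _ = _ := by ring
    have hsplit : u₁ s - u₂ s = (-a₂ - -a₁) + (g s (y₁ s) - g s (y₂ s)) := by
      rw [← hab₁, ← hab₂]
      simp only
      abel
    rw [hsplit, inner_add_right]
    linarith
end
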